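/- arXiv:2603.20717 — 3 statements merged into one kernel-verified Lean document; each statement's English description precedes it below -/
import Mathlib

section
/- Let λ = (λ₁,…,λ₉) be real numbers with λ₁ ≥ λ₂ ≥ … ≥ λ₉ > 0 and λ₁ + ⋯ + λ₉ = 1, and suppose the set {λ₁,…,λ₉} consists of exactly three distinct values a > b > c > 0. If l₁(λ) ≥ 0, l₂(λ) ≥ 0, and at least one of l₁(λ), l₂(λ) equals zero, then 4·λ₇·λ₉ − (λ₁ − λ₈)² ≥ 0. -/
noncomputable section

/-- The matrix `L₁(x)` for a vector `x = (x₁,…,x₉)` (indexed as `x 0, …, x 8`). -/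
def L1m (x : Fin 9 → ℝ) : Matrix (Fin 3) (Fin 3) ℝ :=
  !![2 * x 8, x 7 - x 0, x 5 - x 1;
     x 7 - x 0, 2 * x 6, x 4 - x 2;
     x 5 - x 1, x 4 - x 2, 2 * x 3]

/-- The matrix `L₂(x)` for a vector `x = (x₁,…,x₉)` (indexed as `x 0, …, x 8`). -/
def L2m (x : Fin 9 → ℝ) : Matrix (Fin 3) (Fin 3) ℝ :=
  !![2 * x 8, x 7 - x 0, x 6 - x 1;
     x 7 - x 0, 2 * x 5, x 4 - x 2;
     x 6 - x 1, x 4 - x 2, 2 * x 3]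

/-- `l₁(x) = det L₁(x)`. -/
def l1 (x : Fin 9 → ℝ) : ℝ := (L1m x).det

/-- `l₂(x) = det L₂(x)`. -/
def l2 (x : Fin 9 → ℝ) : ℝ := (L2m x).det

/-- The determinant of a real symmetric `3 × 3` matrix with nonnegative diagonal entries and
nonpositive off-diagonal entries is at most its last diagonal entry times its leading
`2 × 2` minor. -/
theorem det_fin_three_le_of_offDiag_nonpos {d e f p q r : ℝ} (hd : 0 ≤ d) (he : 0 ≤ e)
    (hp : p ≤ 0) (hq : q ≤ 0) (hr : r ≤ 0) :
    (!![d, p, q; p, e, r; q, r, f] : Matrix (Fin 3) (Fin 3) ℝ).det ≤ f * (d * e - p ^ 2) := by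
  have hdr : 0 ≤ d * r ^ 2 := by positivity
  have heq : 0 ≤ e * q ^ 2 := by positivity
  have hpqr : p * q * r ≤ 0 :=
    mul_nonpos_of_nonneg_of_nonpos (mul_nonneg_of_nonpos_of_nonpos hp hq) hr
  simp [Matrix.det_fin_three]
  linarith

/-- for a decreasing positive eigenvalue vector of trace one taking exactly
the three distinct values a > b > c > 0, if l₁(λ) ≥ 0, l₂(λ) ≥ 0 and one of them is zero,
then 4λ₇λ₉ − (λ₁ − λ₈)² ≥ 0. -/
theorem four_l7_l9_ineq (lam : Fin 9 → ℝ) (a b c : ℝ)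
    (hanti : Antitone lam) (hpos : 0 < lam 8) (hsum : ∑ i, lam i = 1)
    (hab : b < a) (hbc : c < b) (hc : 0 < c)
    (hrange : Set.range lam = {a, b, c})
    (h1 : 0 ≤ l1 lam) (h2 : 0 ≤ l2 lam)
    (h0 : l1 lam = 0 ∨ l2 lam = 0) :
    0 ≤ 4 * lam 6 * lam 8 - (lam 0 - lam 7) ^ 2 := by
  have hpos' (i : Fin 9) : 0 < lam i := hpos.trans_le (hanti (Fin.le_last i))
  have hoff {i j : Fin 9} (hij : i ≤ j) : lam j - lam i ≤ 0 := sub_nonpos.mpr (hanti hij)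
  have hdet : l1 lam ≤ 2 * lam 3 * (2 * lam 8 * (2 * lam 6) - (lam 7 - lam 0) ^ 2) :=
    det_fin_three_le_of_offDiag_nonpos (by linarith [hpos' 8]) (by linarith [hpos' 6])
      (hoff (by decide)) (hoff (by decide)) (hoff (by decide))
  have hminor := nonneg_of_mul_nonneg_right (h1.trans hdet) (by linarith [hpos' 3])
  linarith
end
end

section
/- For every real c with 1/21 < c < 1/11 and b = (1−6c)/5, the 9×9 diagonal matrix ν = diag(3c, b, b, b, b, b, c, c, c) belongs to AP_{3,3} but is not an extreme point of AP_{3,3}. -/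
open Matrix ComplexOrder

noncomputable section

/-- Index type for a two-qutrit system. -/
abbrev QIdx : Type := Fin 3 × Fin 3

/-- Partial transpose: `PT M ((i,j),(k,l)) = M ((i,l),(k,j))`. -/
def PT (M : Matrix QIdx QIdx ℂ) : Matrix QIdx QIdx ℂ :=
  fun p q => M (p.1, q.2) (q.1, p.2)

/-- The set of absolutely PPT two-qutrit states. -/
def AP33 : Set (Matrix QIdx QIdx ℂ) :=
  {ρ | ρ.PosSemidef ∧ ρ.trace = 1 ∧
    ∀ U : Matrix QIdx QIdx ℂ, U ∈ Matrix.unitaryGroup QIdx ℂ →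
      (PT (U * ρ * Uᴴ)).PosSemidef}

/-- The 9×9 diagonal matrix with prescribed real diagonal entries
(listed in order), regarded as a matrix indexed by `QIdx`. -/
def diag9 (d : Fin 9 → ℝ) : Matrix QIdx QIdx ℂ :=
  Matrix.diagonal fun p => ((d ((finProdFinEquiv.trans (finCongr (by norm_num))) p) : ℝ) : ℂ)

/-- A complex square matrix has a singular value decomposition. -/
theorem exists_singular_value_decomposition {n : Type*} [Fintype n] [DecidableEq n]
    (X : Matrix n n ℂ) :
    ∃ A ∈ Matrix.unitaryGroup n ℂ, ∃ V ∈ Matrix.unitaryGroup n ℂ, ∃ s : n → ℝ,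
      (∀ i, 0 ≤ s i) ∧ X = A * Matrix.diagonal (fun i => (s i : ℂ)) * Vᴴ := by
  have hps := Matrix.posSemidef_conjTranspose_mul_self X
  have hH := hps.isHermitian
  have hnn := hps.eigenvalues_nonneg
  set V : Matrix n n ℂ := (hH.eigenvectorUnitary : Matrix n n ℂ) with hV
  have hVm : V ∈ Matrix.unitaryGroup n ℂ := hH.eigenvectorUnitary.2
  have hV1 : Vᴴ * V = 1 := Matrix.mem_unitaryGroup_iff'.1 hVm
  have hV2 : V * Vᴴ = 1 := Matrix.mem_unitaryGroup_iff.1 hVm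
  set Y := X * V with hY
  have hYY : Yᴴ * Y = Matrix.diagonal (fun i => (hH.eigenvalues i : ℂ)) := by
    have h := hH.spectral_theorem
    rw [Unitary.conjStarAlgAut_apply] at h
    change Xᴴ * X = V * Matrix.diagonal (fun i => (hH.eigenvalues i : ℂ)) * Vᴴ at h
    calc Yᴴ * Y = Vᴴ * (Xᴴ * X) * V := by
          simp only [hY, Matrix.conjTranspose_mul, Matrix.mul_assoc]
      _ = (Vᴴ * V) * Matrix.diagonal (fun i => (hH.eigenvalues i : ℂ)) * (Vᴴ * V) := by
          refine (congrArg (fun Z => Vᴴ * Z * V) h).trans ?_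
          simp only [Matrix.mul_assoc]
      _ = _ := by rw [hV1, one_mul, mul_one]
  let y : n → EuclideanSpace ℂ n := fun j => WithLp.toLp 2 (fun i => Y i j)
  have hinner : ∀ i j, inner ℂ (y i) (y j) = if i = j then (hH.eigenvalues i : ℂ) else 0 := by
    intro i j
    have := congrFun (congrFun hYY i) j
    rw [Matrix.diagonal_apply, Matrix.mul_apply] at this
    rw [← this, PiLp.inner_apply]
    refine Finset.sum_congr rfl fun k _ => ?_
    simp [y, mul_comm]
  let s : n → ℝ := fun i => Real.sqrt (hH.eigenvalues i)
  have hss : ∀ i, s i * s i = hH.eigenvalues i := fun i => Real.mul_self_sqrt (hnn i)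
  let v : n → EuclideanSpace ℂ n := fun j => ((s j)⁻¹ : ℂ) • y j
  have hv : Orthonormal ℂ (({j | s j ≠ 0} : Set n).domRestrict v) := by
    rw [orthonormal_iff_ite]
    rintro ⟨i, hi⟩ ⟨j, hj⟩
    rw [Set.mem_ofPred_eq] at hi hj
    simp only [Set.domRestrict_apply, v, inner_smul_left, inner_smul_right, hinner,
      Subtype.mk.injEq]
    split_ifs with h
    · subst h
      have hi' : (s i : ℂ) ≠ 0 := by exact_mod_cast hi
      rw [← hss i]
      push_cast
      simp only [map_inv₀, Complex.conj_ofReal]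
      field_simp
    · simp
  obtain ⟨b, hb⟩ := hv.exists_orthonormalBasis_extension_of_card_eq (by simp)
  let A : Matrix n n ℂ := Matrix.of fun i j => b j i
  have hA : A ∈ Matrix.unitaryGroup n ℂ := by
    rw [Matrix.mem_unitaryGroup_iff']
    ext i j
    have h := orthonormal_iff_ite.1 b.orthonormal i j
    rw [PiLp.inner_apply] at h
    rw [Matrix.mul_apply, Matrix.one_apply, ← h]
    refine Finset.sum_congr rfl fun k _ => ?_
    simp [A, mul_comm]
  have hAY : A * Matrix.diagonal (fun i => (s i : ℂ)) = Y := by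
    ext i j
    rw [Matrix.mul_diagonal]
    by_cases hj : s j = 0
    · have h0 : y j = 0 := by
        rw [← inner_self_eq_zero (𝕜 := ℂ), hinner, if_pos rfl, ← hss j, hj]
        simp
      have : y j i = 0 := by rw [h0]; rfl
      rw [hj]
      simpa [y] using this.symm
    · have hj' : (s j : ℂ) ≠ 0 := by exact_mod_cast hj
      simp only [A, Matrix.of_apply, hb j hj, v, y, PiLp.smul_apply, smul_eq_mul]
      field_simp
  refine ⟨A, hA, V, hVm, s, fun i => Real.sqrt_nonneg _, ?_⟩
  rw [hAY, hY, Matrix.mul_assoc, hV2, mul_one]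

theorem PT_isHermitian {M : Matrix QIdx QIdx ℂ} (hM : M.IsHermitian) : (PT M).IsHermitian := by
  ext p q
  exact hM.apply _ _

/-- The quadratic form of a partial transpose, expressed in the Schmidt basis of the vector. -/
theorem star_dotProduct_PT_mulVec (M : Matrix QIdx QIdx ℂ) (A V : Matrix (Fin 3) (Fin 3) ℂ)
    (s : Fin 3 → ℝ) (x : QIdx → ℂ)
    (hx : ∀ i j, x (i, j) = (A * Matrix.diagonal (fun i => (s i : ℂ)) * Vᴴ) i j) :
    star x ⬝ᵥ (PT M *ᵥ x) = ∑ m, ∑ n, ((s m * s n : ℝ) : ℂ) *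
      ((Matrix.kronecker A V)ᴴ * M * Matrix.kronecker A V) (m, n) (n, m) := by
  have hperm : ∀ F : Fin 3 → Fin 3 → Fin 3 → Fin 3 → Fin 3 → Fin 3 → ℂ,
      ∑ i, ∑ j, ∑ k, ∑ l, ∑ m, ∑ n, F i j k l m n =
        ∑ m, ∑ n, ∑ k, ∑ j, ∑ i, ∑ l, F i j k l m n := by
    intro F
    simp only [← Fintype.sum_prod_type']
    let e : Fin 3 × Fin 3 × Fin 3 × Fin 3 × Fin 3 × Fin 3 ≃
        Fin 3 × Fin 3 × Fin 3 × Fin 3 × Fin 3 × Fin 3 :=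
      ⟨fun ⟨i, j, k, l, m, n⟩ => ⟨m, n, k, j, i, l⟩, fun ⟨m, n, k, j, i, l⟩ => ⟨i, j, k, l, m, n⟩,
       fun _ => rfl, fun _ => rfl⟩
    exact Fintype.sum_equiv e _ _ fun _ => rfl
  have hx' : ∀ i j, x (i, j) = ∑ m, A i m * s m * star (V j m) := by
    intro i j
    rw [hx, Matrix.mul_apply]
    simp [Matrix.mul_diagonal]
  have hL : star x ⬝ᵥ (PT M *ᵥ x) = ∑ i, ∑ j, ∑ k, ∑ l, ∑ m, ∑ n,
      star (A i m * s m * star (V j m)) * (M (i, l) (k, j) * (A k n * s n * star (V l n))) := by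
    simp only [dotProduct, Matrix.mulVec, Fintype.sum_prod_type, Pi.star_apply, PT, hx',
      star_sum, Finset.mul_sum, Finset.sum_mul]
    refine Finset.sum_congr rfl fun i _ => Finset.sum_congr rfl fun j _ =>
      Finset.sum_congr rfl fun k _ => Finset.sum_congr rfl fun l _ => ?_
    rw [Finset.sum_comm]
  rw [hL, hperm]
  refine Finset.sum_congr rfl fun m _ => Finset.sum_congr rfl fun n _ => ?_
  simp only [Matrix.mul_apply, Fintype.sum_prod_type, Finset.mul_sum, Finset.sum_mul]
  refine Finset.sum_congr rfl fun k _ => Finset.sum_congr rfl fun j _ =>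
    Finset.sum_congr rfl fun i _ => Finset.sum_congr rfl fun l _ => ?_
  simp only [Matrix.conjTranspose_apply, Matrix.kronecker, Matrix.kroneckerMap_apply, star_mul',
    RCLike.star_def, Complex.conj_ofReal, Complex.ofReal_mul, Complex.conj_conj]
  ring

/-- A Hermitian matrix has positive semidefinite partial transpose as soon as, in every product
basis, its partial transpose is nonnegative on diagonal vectors. -/
theorem posSemidef_PT_of_forall_unitary {M : Matrix QIdx QIdx ℂ} (hM : M.IsHermitian)
    (h : ∀ K ∈ Matrix.unitaryGroup QIdx ℂ, ∀ s : Fin 3 → ℝ, (∀ i, 0 ≤ s i) →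
      0 ≤ ∑ m, ∑ n, s m * s n * ((Kᴴ * M * K) (m, n) (n, m)).re) :
    (PT M).PosSemidef := by
  refine Matrix.PosSemidef.of_dotProduct_mulVec_nonneg (PT_isHermitian hM) fun x => ?_
  obtain ⟨A, hA, V, hV, s, hs, hX⟩ :=
    exists_singular_value_decomposition (Matrix.of fun i j => x (i, j))
  have hform := star_dotProduct_PT_mulVec M A V s x fun i j => by rw [← hX]; rfl
  have hre := h _ (Matrix.kronecker_mem_unitary hA hV) s hs
  have him : (star x ⬝ᵥ (PT M *ᵥ x)).im = 0 :=
    (PT_isHermitian hM).im_star_dotProduct_mulVec_self x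
  rw [Complex.nonneg_iff]
  refine ⟨?_, him.symm⟩
  rw [hform]
  simp only [Complex.re_sum, Complex.re_ofReal_mul]
  exact hre

theorem re_diag_nonneg {N : Matrix QIdx QIdx ℂ} (hN : N.PosSemidef) (p : QIdx) :
    0 ≤ (N p p).re :=
  (Complex.nonneg_iff.1 hN.diag_nonneg).1

theorem re_apply_symm {N : Matrix QIdx QIdx ℂ} (hN : N.IsHermitian) (p q : QIdx) :
    (N q p).re = (N p q).re := by
  rw [← hN.apply p q]
  simp

theorem re_add_nonneg {N : Matrix QIdx QIdx ℂ} (hN : N.PosSemidef) (p q : QIdx) :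
    0 ≤ (N p p).re + (N q q).re + 2 * (N p q).re := by
  have h := (Complex.nonneg_iff.1
    (hN.dotProduct_mulVec_nonneg (Pi.single p 1 + Pi.single q 1))).1
  simp [Matrix.mulVec_add, add_dotProduct, dotProduct_add] at h
  linarith [re_apply_symm hN.isHermitian p q]

theorem re_sub_nonneg {N : Matrix QIdx QIdx ℂ} (hN : N.PosSemidef) (p q : QIdx) :
    0 ≤ (N p p).re + (N q q).re - 2 * (N p q).re := by
  have h := (Complex.nonneg_iff.1
    (hN.dotProduct_mulVec_nonneg (Pi.single p 1 - Pi.single q 1))).1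
  simp [Matrix.mulVec_sub, sub_dotProduct, dotProduct_sub] at h
  linarith [re_apply_symm hN.isHermitian p q]

theorem re_trace_eq {N : Matrix QIdx QIdx ℂ} : N.trace.re = ∑ i, ∑ j, (N (i, j) (i, j)).re := by
  simp only [Matrix.trace, Complex.re_sum, Fintype.sum_prod_type, Matrix.diag_apply]

theorem trace_conj_unitary {K : Matrix QIdx QIdx ℂ} (hK : K ∈ Matrix.unitaryGroup QIdx ℂ)
    (M : Matrix QIdx QIdx ℂ) : (Kᴴ * M * K).trace = M.trace := by
  have h : K * Kᴴ = 1 := Matrix.mem_unitaryGroup_iff.1 hK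
  rw [Matrix.trace_mul_comm, ← Matrix.mul_assoc, h, one_mul]

/-- The partial transpose of a state has no eigenvalue below `-1/2`. -/
theorem posSemidef_PT_one_add {Q : Matrix QIdx QIdx ℂ} (hQ : Q.PosSemidef) (htr : Q.trace = 1) :
    (PT (1 + (2 : ℝ) • Q)).PosSemidef := by
  refine posSemidef_PT_of_forall_unitary
    (Matrix.PosSemidef.one.add (hQ.smul zero_le_two)).isHermitian fun K hK s hs => ?_
  have hKK : Kᴴ * K = 1 := Matrix.mem_unitaryGroup_iff'.1 hK
  have hN := hQ.conjTranspose_mul_mul_same K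
  have ht : (Kᴴ * Q * K).trace.re = 1 := by rw [trace_conj_unitary hK, htr, Complex.one_re]
  have hE : Kᴴ * (1 + (2 : ℝ) • Q) * K = 1 + (2 : ℝ) • (Kᴴ * Q * K) := by
    simp [Matrix.mul_add, Matrix.add_mul, hKK]
  rw [hE]
  generalize Kᴴ * Q * K = N at hN ht
  rw [re_trace_eq] at ht
  simp only [Fin.sum_univ_three] at ht ⊢
  have e := fun p => re_diag_nonneg hN p
  have h01 := re_add_nonneg hN (0, 1) (1, 0)
  have h02 := re_add_nonneg hN (0, 2) (2, 0)
  have h12 := re_add_nonneg hN (1, 2) (2, 1)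
  have g01 := re_apply_symm hN.isHermitian (0, 1) (1, 0)
  have g02 := re_apply_symm hN.isHermitian (0, 2) (2, 0)
  have g12 := re_apply_symm hN.isHermitian (1, 2) (2, 1)
  simp
  rw [g01, g02, g12]
  have p01 := mul_nonneg (hs 0) (hs 1)
  have p02 := mul_nonneg (hs 0) (hs 2)
  have p12 := mul_nonneg (hs 1) (hs 2)
  have q : s 0 ^ 2 + s 1 ^ 2 + s 2 ^ 2 = (s 0 ^ 2 + s 1 ^ 2 + s 2 ^ 2) * 1 := by ring
  rw [← ht] at q
  have d (i : Fin 3) (w : ℝ) (hw : 0 ≤ w) : 0 ≤ s i ^ 2 * w := mul_nonneg (sq_nonneg _) hw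
  have o (i j k : Fin 3) (w : ℝ) (hw : 0 ≤ w) :
      0 ≤ ((s i - s j) ^ 2 + s k ^ 2) * w := by positivity
  linarith [mul_nonneg p01 h01, mul_nonneg p02 h02, mul_nonneg p12 h12,
    d 0 _ (e (0, 0)), d 1 _ (e (0, 0)), d 2 _ (e (0, 0)),
    d 0 _ (e (1, 1)), d 1 _ (e (1, 1)), d 2 _ (e (1, 1)),
    d 0 _ (e (2, 2)), d 1 _ (e (2, 2)), d 2 _ (e (2, 2)),
    o 0 1 2 _ (e (0, 1)), o 0 1 2 _ (e (1, 0)), o 0 2 1 _ (e (0, 2)), o 0 2 1 _ (e (2, 0)),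
    o 1 2 0 _ (e (1, 2)), o 1 2 0 _ (e (2, 1))]

theorem weighted_products_le_of_ordered {x y z a b c p q r : ℝ} (hz : 0 ≤ z) (hzy : z ≤ y)
    (hyx : y ≤ x) (ha : a ≤ 1) (hb0 : 0 ≤ b) (hc0 : 0 ≤ c) (hp : p ≤ 1)
    (hq0 : 0 ≤ q) (hr0 : 0 ≤ r) (hsum : a + b + c + p + q + r ≤ 3) :
    x ^ 2 * a + y ^ 2 * b + z ^ 2 * c + x * y * p + x * z * q + y * z * r ≤
      3 / 2 * (x ^ 2 + y ^ 2 + z ^ 2) := by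
  have hy : 0 ≤ y := hz.trans hzy
  have hx : 0 ≤ x := hy.trans hyx
  have h1 : y * z ≤ y ^ 2 := by nlinarith
  have h2 : z ^ 2 ≤ y * z := by nlinarith
  have h3 : y * z ≤ x * z := by nlinarith
  have h4 : y ^ 2 ≤ x * y := by nlinarith
  have h5 : x * z ≤ x * y := by nlinarith
  have h6 : x * y ≤ x ^ 2 := by nlinarith
  rcases le_total (x * z) (y ^ 2) with h | h
  · have k1 := mul_nonneg (sub_nonneg.2 (h4.trans h6)) (sub_nonneg.2 ha)
    have k2 := mul_nonneg (sub_nonneg.2 h4) (sub_nonneg.2 hp)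
    have k3 := mul_nonneg (sub_nonneg.2 (h2.trans h1)) hc0
    have k4 := mul_nonneg (sub_nonneg.2 h) hq0
    have k5 := mul_nonneg (sub_nonneg.2 h1) hr0
    have k6 := mul_nonneg (sq_nonneg y) (sub_nonneg.2 hsum)
    nlinarith [sq_nonneg (x - y), sq_nonneg z]
  · have k1 := mul_nonneg (sub_nonneg.2 (h5.trans h6)) (sub_nonneg.2 ha)
    have k2 := mul_nonneg (sub_nonneg.2 h5) (sub_nonneg.2 hp)
    have k3 := mul_nonneg (sub_nonneg.2 (h2.trans h3)) hc0
    have k4 := mul_nonneg (sub_nonneg.2 h) hb0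
    have k5 := mul_nonneg (sub_nonneg.2 h3) hr0
    have k6 := mul_nonneg (mul_nonneg hx hz) (sub_nonneg.2 hsum)
    nlinarith [sq_nonneg (x - y - z), sq_nonneg (y - z), sq_nonneg y, sq_nonneg z]

theorem weighted_products_le {x y z a b c p q r : ℝ} (hx : 0 ≤ x) (hy : 0 ≤ y) (hz : 0 ≤ z)
    (ha : a ≤ 1) (ha0 : 0 ≤ a) (hb : b ≤ 1) (hb0 : 0 ≤ b) (hc : c ≤ 1) (hc0 : 0 ≤ c)
    (hp : p ≤ 1) (hp0 : 0 ≤ p) (hq : q ≤ 1) (hq0 : 0 ≤ q) (hr : r ≤ 1) (hr0 : 0 ≤ r)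
    (hsum : a + b + c + p + q + r ≤ 3) :
    x ^ 2 * a + y ^ 2 * b + z ^ 2 * c + x * y * p + x * z * q + y * z * r ≤
      3 / 2 * (x ^ 2 + y ^ 2 + z ^ 2) := by
  rcases le_total x y with hxy | hxy <;> rcases le_total y z with hyz | hyz <;>
    rcases le_total x z with hxz | hxz
  · linarith [weighted_products_le_of_ordered (a := c) (b := b) (c := a) (p := r) (q := q) (r := p)
      hx hxy hyz hc hb0 ha0 hr hq0 hp0 (by linarith)]
  · linarith [weighted_products_le_of_ordered (a := c) (b := b) (c := a) (p := r) (q := q) (r := p)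
      hx hxy hyz hc hb0 ha0 hr hq0 hp0 (by linarith)]
  · linarith [weighted_products_le_of_ordered (a := b) (b := c) (c := a) (p := r) (q := p) (r := q)
      hx hxz hyz hb hc0 ha0 hr hp0 hq0 (by linarith)]
  · linarith [weighted_products_le_of_ordered (a := b) (b := a) (c := c) (p := p) (q := r) (r := q)
      hz hxz hxy hb ha0 hc0 hp hr0 hq0 (by linarith)]
  · linarith [weighted_products_le_of_ordered (a := c) (b := a) (c := b) (p := q) (q := r) (r := p)
      hy hxy hxz hc ha0 hb0 hq hr0 hp0 (by linarith)]
  · linarith [weighted_products_le_of_ordered (a := a) (b := c) (c := b) (p := q) (q := p) (r := r)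
      hy hyz hxz ha hc0 hb0 hq hp0 hr0 (by linarith)]
  · linarith [weighted_products_le_of_ordered (a := a) (b := b) (c := c) (p := p) (q := q) (r := r)
      hz hyz hxy ha hb0 hc0 hp hq0 hr0 (by linarith)]
  · linarith [weighted_products_le_of_ordered (a := a) (b := b) (c := c) (p := p) (q := q) (r := r)
      hz hyz hxy ha hb0 hc0 hp hq0 hr0 (by linarith)]

/-- If `0 ≤ P ≤ 1` has trace `3`, the partial transpose of `P` is at most `3/2`. -/
theorem posSemidef_PT_three_sub {P : Matrix QIdx QIdx ℂ} (hP : P.PosSemidef)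
    (hP1 : (1 - P).PosSemidef) (htr : P.trace = 3) :
    (PT ((3 : ℝ) • (1 : Matrix QIdx QIdx ℂ) - (2 : ℝ) • P)).PosSemidef := by
  have hHerm : ((3 : ℝ) • (1 : Matrix QIdx QIdx ℂ) - (2 : ℝ) • P).IsHermitian :=
    (Matrix.PosSemidef.one.smul (by norm_num : (0 : ℝ) ≤ 3)).isHermitian.sub
      (hP.smul zero_le_two).isHermitian
  refine posSemidef_PT_of_forall_unitary hHerm fun K hK s hs => ?_
  have hKK : Kᴴ * K = 1 := Matrix.mem_unitaryGroup_iff'.1 hK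
  have hN := hP.conjTranspose_mul_mul_same K
  have hN1 := hP1.conjTranspose_mul_mul_same K
  have ht : (Kᴴ * P * K).trace.re = 3 := by rw [trace_conj_unitary hK, htr]; rfl
  have hE : Kᴴ * ((3 : ℝ) • (1 : Matrix QIdx QIdx ℂ) - (2 : ℝ) • P) * K =
      (3 : ℝ) • (1 : Matrix QIdx QIdx ℂ) - (2 : ℝ) • (Kᴴ * P * K) := by
    simp [Matrix.mul_sub, Matrix.sub_mul, hKK]
  have hE1 : Kᴴ * (1 - P) * K = 1 - Kᴴ * P * K := by
    simp [Matrix.mul_sub, Matrix.sub_mul, hKK]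
  rw [hE]
  rw [hE1] at hN1
  generalize Kᴴ * P * K = N at hN hN1 ht
  rw [re_trace_eq] at ht
  simp only [Fin.sum_univ_three] at ht ⊢
  have e := fun p => re_diag_nonneg hN p
  have f : ∀ p, (N p p).re ≤ 1 := fun p => by
    have := re_diag_nonneg hN1 p
    simp at this
    exact this
  have a01 := re_add_nonneg hN (0, 1) (1, 0)
  have a02 := re_add_nonneg hN (0, 2) (2, 0)
  have a12 := re_add_nonneg hN (1, 2) (2, 1)
  have b01 := re_sub_nonneg hN (0, 1) (1, 0)
  have b02 := re_sub_nonneg hN (0, 2) (2, 0)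
  have b12 := re_sub_nonneg hN (1, 2) (2, 1)
  have c01 := re_add_nonneg hN1 (0, 1) (1, 0)
  have c02 := re_add_nonneg hN1 (0, 2) (2, 0)
  have c12 := re_add_nonneg hN1 (1, 2) (2, 1)
  simp at c01 c02 c12
  have g01 := re_apply_symm hN.isHermitian (0, 1) (1, 0)
  have g02 := re_apply_symm hN.isHermitian (0, 2) (2, 0)
  have g12 := re_apply_symm hN.isHermitian (1, 2) (2, 1)
  simp
  rw [g01, g02, g12]
  have key := weighted_products_le (hs 0) (hs 1) (hs 2)
    (f (0, 0)) (e (0, 0)) (f (1, 1)) (e (1, 1)) (f (2, 2)) (e (2, 2))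
    (p := ((N (0, 1) (0, 1)).re + (N (1, 0) (1, 0)).re + 2 * (N (0, 1) (1, 0)).re) / 2)
    (by linarith) (by linarith)
    (q := ((N (0, 2) (0, 2)).re + (N (2, 0) (2, 0)).re + 2 * (N (0, 2) (2, 0)).re) / 2)
    (by linarith) (by linarith)
    (r := ((N (1, 2) (1, 2)).re + (N (2, 1) (2, 1)).re + 2 * (N (1, 2) (2, 1)).re) / 2)
    (by linarith) (by linarith) (by linarith)
  linarith [mul_nonneg (mul_nonneg (hs 0) (hs 1)) b01, mul_nonneg (mul_nonneg (hs 0) (hs 2)) b02,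
    mul_nonneg (mul_nonneg (hs 1) (hs 2)) b12]

/-- The family of diagonal states under consideration. -/
def nuState (c : ℝ) : Matrix QIdx QIdx ℂ :=
  diag9 ![3 * c, (1 - 6 * c) / 5, (1 - 6 * c) / 5, (1 - 6 * c) / 5, (1 - 6 * c) / 5,
    (1 - 6 * c) / 5, c, c, c]

theorem nuState_eq (c : ℝ) : nuState c =
    ((21 * c - 1) / 10) • (1 + (2 : ℝ) •
      Matrix.diagonal (fun p : QIdx => if p = (0, 0) then (1 : ℂ) else 0)) +
    ((1 - 11 * c) / 10) • ((3 : ℝ) • (1 : Matrix QIdx QIdx ℂ) - (2 : ℝ) •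
      Matrix.diagonal (fun p : QIdx => if p.1 = 2 then (1 : ℂ) else 0)) := by
  ext p q
  by_cases h : p = q
  · subst h
    simp only [nuState, diag9, Matrix.diagonal_apply_eq, Matrix.add_apply, Matrix.smul_apply,
      Matrix.sub_apply, Matrix.one_apply_eq]
    fin_cases p <;> simp [finProdFinEquiv] <;> ring
  · simp [nuState, diag9, h]

theorem diagonal_indicator_posSemidef (S : QIdx → Prop) [DecidablePred S] :
    (Matrix.diagonal (fun p : QIdx => if S p then (1 : ℂ) else 0)).PosSemidef := by
  refine Matrix.PosSemidef.diagonal fun p => ?_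
  by_cases h : S p <;> simp [h]

theorem one_sub_diagonal_indicator_posSemidef (S : QIdx → Prop) [DecidablePred S] :
    (1 - Matrix.diagonal (fun p : QIdx => if S p then (1 : ℂ) else 0)).PosSemidef := by
  rw [← Matrix.diagonal_one, Matrix.diagonal_sub]
  refine Matrix.PosSemidef.diagonal fun p => ?_
  by_cases h : S p <;> simp [h]

theorem trace_diagonal_last_row :
    (Matrix.diagonal (fun p : QIdx => if p.1 = 2 then (1 : ℂ) else 0)).trace = 3 := by
  rw [Matrix.trace_diagonal, Fintype.sum_prod_type]
  have h0 : (0 : Fin 3) ≠ 2 := by decide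
  have h1 : (1 : Fin 3) ≠ 2 := by decide
  simp only [Fin.sum_univ_three, if_neg h0, if_neg h1, if_true]
  norm_num

theorem PT_add (M N : Matrix QIdx QIdx ℂ) : PT (M + N) = PT M + PT N := rfl

theorem PT_smul (a : ℝ) (M : Matrix QIdx QIdx ℂ) : PT (a • M) = a • PT M := rfl

theorem nuState_mem_AP33 {c : ℝ} (hc1 : 1 / 21 ≤ c) (hc2 : c ≤ 1 / 11) : nuState c ∈ AP33 := by
  refine ⟨?_, ?_, fun U hU => ?_⟩
  · refine Matrix.PosSemidef.diagonal fun p => ?_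
    have h1 : 0 ≤ c := by linarith
    have h2 : 0 ≤ (1 - 6 * c) / 5 := by linarith
    have h3 : 0 ≤ 3 * c := by linarith
    rw [Pi.zero_apply, Complex.zero_le_real]
    fin_cases p <;> simp [finProdFinEquiv] <;> linarith
  · rw [nuState_eq]
    simp only [Matrix.trace_add, Matrix.trace_smul, Matrix.trace_sub, Matrix.trace_one,
      trace_diagonal_last_row]
    simp [Matrix.trace_diagonal]
    ring
  · have hUU : U * Uᴴ = 1 := Matrix.mem_unitaryGroup_iff.1 hU
    have hU' : Uᴴ * U = 1 := Matrix.mem_unitaryGroup_iff'.1 hU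
    have htr (M : Matrix QIdx QIdx ℂ) : (U * M * Uᴴ).trace = M.trace := by
      rw [Matrix.trace_mul_comm, ← Matrix.mul_assoc, hU', one_mul]
    set E := Matrix.diagonal (fun p : QIdx => if p = (0, 0) then (1 : ℂ) else 0) with hE
    set F := Matrix.diagonal (fun p : QIdx => if p.1 = 2 then (1 : ℂ) else 0) with hF
    have hsplit : U * nuState c * Uᴴ =
        ((21 * c - 1) / 10) • (1 + (2 : ℝ) • (U * E * Uᴴ)) +
        ((1 - 11 * c) / 10) • ((3 : ℝ) • (1 : Matrix QIdx QIdx ℂ) - (2 : ℝ) • (U * F * Uᴴ)) := by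
      rw [nuState_eq]
      simp only [Matrix.mul_add, Matrix.add_mul, Matrix.mul_sub, Matrix.sub_mul, Matrix.mul_smul,
        Matrix.smul_mul, mul_one, hUU, hE, hF]
    rw [hsplit, PT_add, PT_smul, PT_smul]
    refine Matrix.PosSemidef.add (Matrix.PosSemidef.smul (posSemidef_PT_one_add ?_ ?_) ?_)
      (Matrix.PosSemidef.smul (posSemidef_PT_three_sub ?_ ?_ ?_) ?_)
    · exact (diagonal_indicator_posSemidef _).mul_mul_conjTranspose_same U
    · rw [htr, hE, Matrix.trace_diagonal]
      simp
    · linarith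
    · exact (diagonal_indicator_posSemidef _).mul_mul_conjTranspose_same U
    · have := (one_sub_diagonal_indicator_posSemidef
        (fun p : QIdx => p.1 = 2)).mul_mul_conjTranspose_same U
      rwa [Matrix.mul_sub, Matrix.sub_mul, mul_one, hUU] at this
    · rw [htr, hF, trace_diagonal_last_row]
    · linarith

theorem nuState_injective : Function.Injective nuState := by
  intro c d h
  have := congrFun (congrFun h (2, 2)) (2, 2)
  simpa [nuState, diag9, finProdFinEquiv] using this

/-- for 1/21 < c < 1/11 and b = (1−6c)/5, the state
diag(3c, b, b, b, b, b, c, c, c) belongs to AP_{3,3} but is not an extreme point. -/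
theorem nu153_not_extreme (c : ℝ) (hc1 : 1 / 21 < c) (hc2 : c < 1 / 11) :
    diag9 ![3 * c, (1 - 6 * c) / 5, (1 - 6 * c) / 5, (1 - 6 * c) / 5, (1 - 6 * c) / 5,
        (1 - 6 * c) / 5, c, c, c] ∈ AP33 ∧
    diag9 ![3 * c, (1 - 6 * c) / 5, (1 - 6 * c) / 5, (1 - 6 * c) / 5, (1 - 6 * c) / 5,
        (1 - 6 * c) / 5, c, c, c] ∉ Set.extremePoints ℝ AP33 := by
  have hmem : nuState c ∈ AP33 := nuState_mem_AP33 hc1.le hc2.le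
  refine ⟨hmem, fun hext => ?_⟩
  have hseg : nuState c ∈ openSegment ℝ (nuState (1 / 21)) (nuState (1 / 11)) := by
    refine ⟨(1 / 11 - c) * (231 / 10), (c - 1 / 21) * (231 / 10), by linarith, by linarith,
      by ring, ?_⟩
    rw [nuState_eq, nuState_eq, nuState_eq]
    module
  have h := (mem_extremePoints.1 hext).2 _ (nuState_mem_AP33 le_rfl (by norm_num)) _
    (nuState_mem_AP33 (by norm_num) le_rfl) hseg
  exact hc1.ne (nuState_injective h.1)
end
end

section
/- Let b, c be reals with a := 1 − 2b − 6c satisfying a > b > c > 0, and let λ = (a, b, b, c, c, c, c, c, c). If l₁(λ) = 0, then 1/12 < c < 1/11 and b = 2c − √(12c² − c) (hence a = 1 − 10c + 2√(12c² − c)). -/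
noncomputable section

/-- if a = 1 − 2b − 6c > b > c > 0 and l₁(a, b, b, c, c, c, c, c, c) = 0, then
1/12 < c < 1/11, b = 2c − √(12c² − c), and hence a = 1 − 10c + 2√(12c² − c). -/
theorem nu126_parameters (b c : ℝ)
    (ha : b < 1 - 2 * b - 6 * c) (hb : c < b) (hc : 0 < c)
    (hl : l1 ![1 - 2 * b - 6 * c, b, b, c, c, c, c, c, c] = 0) :
    1 / 12 < c ∧ c < 1 / 11 ∧ b = 2 * c - Real.sqrt (12 * c ^ 2 - c) ∧
      1 - 2 * b - 6 * c = 1 - 10 * c + 2 * Real.sqrt (12 * c ^ 2 - c) := by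
  have hprod : (1 - 2 * b - 5 * c) * ((b - 2 * c) ^ 2 - (12 * c ^ 2 - c)) = 0 := by
    simp [l1, L1m, Matrix.det_fin_three] at hl
    linarith
  have hsq : (2 * c - b) ^ 2 = 12 * c ^ 2 - c := by
    rcases mul_eq_zero.mp hprod with h | h <;> linarith
  have hlt : b < 2 * c := by
    by_contra! h
    nlinarith [mul_pos hc (sub_pos.mpr ha), mul_nonneg (sub_nonneg.mpr h) (add_pos (hc.trans hb) hc).le]
  have hsqrt : Real.sqrt (12 * c ^ 2 - c) = 2 * c - b := by
    rw [← hsq, Real.sqrt_sq (by linarith)]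
  refine ⟨?_, ?_, by linarith, by linarith⟩
  · have : 0 < c * (12 * c - 1) := by nlinarith [pow_pos (sub_pos.mpr hlt) 2]
    linarith [pos_of_mul_pos_right this hc.le]
  · have : 0 < c * (1 - 11 * c) := by
      nlinarith [mul_pos (sub_pos.mpr hb) (show 0 < 3 * c - b by linarith)]
    linarith [pos_of_mul_pos_right this hc.le]
end
end
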